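/- For every N ≥ 1 and all u, v, w ∈ (0,∞), setting T_N(u,v,w) = Σ_{t=1}^{N} Σ_{s=1}^{⌊t/2⌋} C(N, 2s)·C(N−2s, t−2s)·(u+v)^s·(w/2)^{t−2s} and S_N(u,v,w) = 1 + Σ_{t=1}^{N} Σ_{s=1}^{⌊t/2⌋} C(N−t+s, s)·C(t−s−1, s−1)·((u+v)/4)^s·(w/2)^{t−2s}, one has the two-sided estimate 1 + (C₁/(2^N √N))·T_N(u,v,w) ≤ S_N(u,v,w) ≤ 1 + (1/√N)·T_N(u,v,w), where C₁ = e^{−1/6}·√(2/π). -/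

import Mathlib

/-- A binomial coefficient away from both ends of its row is at least the row index. -/
theorem Nat.le_choose_of_pos_of_lt : ∀ {n k : ℕ}, 0 < k → k < n → n ≤ n.choose k
  | 0, _, _, h => absurd h (Nat.not_lt_zero _)
  | _ + 1, 0, h, _ => absurd h (Nat.lt_irrefl _)
  | n + 1, k + 1, _, h => by
    rw [Nat.choose_succ_succ]
    rcases Nat.eq_or_lt_of_le (Nat.le_of_lt_succ h) with rfl | h'
    · simp [Nat.choose_succ_self_right]
    · have ih := Nat.le_choose_of_pos_of_lt (Nat.succ_pos k) h'
      have hpos : 0 < n.choose k := Nat.choose_pos (by omega)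
      rw [Nat.succ_eq_add_one] at ih ⊢
      omega

theorem Nat.centralBinom_sq_mul_le (n : ℕ) : n.centralBinom ^ 2 * (2 * n + 1) ≤ 16 ^ n := by
  induction n with
  | zero => simp
  | succ n ih =>
    have h := Nat.succ_mul_centralBinom_succ n
    refine Nat.le_of_mul_le_mul_left ?_ (show 0 < (n + 1) ^ 2 by positivity)
    calc (n + 1) ^ 2 * ((n + 1).centralBinom ^ 2 * (2 * (n + 1) + 1))
        = ((n + 1) * (n + 1).centralBinom) ^ 2 * (2 * n + 3) := by ring
      _ = n.centralBinom ^ 2 * (2 * n + 1) * (4 * ((2 * n + 1) * (2 * n + 3))) := by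
        rw [h]; ring
      _ ≤ 16 ^ n * (4 * (4 * (n + 1) ^ 2)) := by
        gcongr ?_ * (4 * ?_)
        nlinarith
      _ = (n + 1) ^ 2 * 16 ^ (n + 1) := by ring

theorem Nat.choose_sq_mul_le (n k : ℕ) : n.choose k ^ 2 * (n + 1) ≤ 4 ^ n := by
  have hmid : n.choose k ^ 2 * (n + 1) ≤ n.choose (n / 2) ^ 2 * (n + 1) := by
    gcongr
    exact Nat.choose_le_middle k n
  refine hmid.trans ?_
  rcases Nat.even_or_odd' n with ⟨m, rfl | rfl⟩
  · have h := m.centralBinom_sq_mul_le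
    rw [Nat.centralBinom_eq_two_mul_choose] at h
    rw [Nat.mul_div_cancel_left m two_pos, pow_mul]
    exact h
  · have h := (m + 1).centralBinom_sq_mul_le
    have hc : (m + 1).centralBinom = 2 * (2 * m + 1).choose m := by
      rw [Nat.centralBinom_eq_two_mul_choose, show 2 * (m + 1) = 2 * m + 1 + 1 by ring,
        Nat.choose_succ_succ, Nat.succ_eq_add_one, Nat.choose_symm_half]
      ring
    rw [hc] at h
    rw [show (2 * m + 1) / 2 = m by omega]
    have hp : (16 : ℕ) ^ (m + 1) = 4 * 4 ^ (2 * m + 1) := by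
      rw [pow_succ 4, pow_mul, pow_succ]; norm_num; ring
    rw [hp] at h
    nlinarith [Nat.zero_le ((2 * m + 1).choose m ^ 2)]

theorem Nat.choose_mul_sqrt_le (n k : ℕ) : (n.choose k : ℝ) * √((n : ℝ) + 1) ≤ 2 ^ n := by
  refine (sq_le_sq₀ (by positivity) (by positivity)).1 ?_
  rw [mul_pow, Real.sq_sqrt (by positivity), ← pow_mul, mul_comm n 2, pow_mul]
  norm_num
  exact_mod_cast Nat.choose_sq_mul_le n k

/-- Two factorizations of the multinomial-type quotient `(2s+m+n)! / (s! s! m! n!)`. -/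
theorem Nat.choose_mul_choose_mul_choose_add (s m n : ℕ) :
    (n + s).choose s * (m + s).choose s * (2 * s + m + n).choose (m + s) =
      (2 * s + m + n).choose (2 * s) * (m + n).choose m * s.centralBinom := by
  have h1 := Nat.add_choose_mul_factorial_mul_factorial n s
  have h2 := Nat.add_choose_mul_factorial_mul_factorial m s
  have h3 := Nat.add_choose_mul_factorial_mul_factorial (n + s) (m + s)
  have h4 := Nat.add_choose_mul_factorial_mul_factorial (m + n) (2 * s)
  have h5 := Nat.add_choose_mul_factorial_mul_factorial n m
  have h6 := Nat.add_choose_mul_factorial_mul_factorial s s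
  rw [show n + s + (m + s) = 2 * s + m + n by ring] at h3
  rw [show m + n + 2 * s = 2 * s + m + n by ring] at h4
  rw [add_comm n m] at h5
  rw [← two_mul, ← Nat.centralBinom_eq_two_mul_choose] at h6
  rw [← h1, ← h2] at h3
  rw [← h5, ← h6, ← h3] at h4
  refine Nat.eq_of_mul_eq_mul_right
    (show 0 < n.factorial * m.factorial * s.factorial * s.factorial by positivity) ?_
  linear_combination -h4

theorem Nat.choose_mul_choose_mul_mul_choose {s : ℕ} (hs : 1 ≤ s) (m n : ℕ) :
    (n + s).choose s * (s + m - 1).choose (s - 1) *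
        ((m + s) * (2 * s + m + n).choose (m + s)) =
      (2 * s + m + n).choose (2 * s) * (m + n).choose m * (s * s.centralBinom) := by
  obtain ⟨r, rfl⟩ := Nat.exists_eq_add_of_le' hs
  have h := Nat.add_one_mul_choose_eq (r + m) r
  have h' := Nat.choose_mul_choose_mul_choose_add (r + 1) m n
  rw [show r + 1 + m - 1 = r + m by omega, Nat.add_sub_cancel]
  rw [show r + m + 1 = m + (r + 1) by ring] at h
  linear_combination (n + (r + 1)).choose (r + 1) * (2 * (r + 1) + m + n).choose (m + (r + 1)) * h
    + (r + 1) * h'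

theorem choose_mul_choose_squeezed {s : ℕ} (hs : 1 ≤ s) (m n : ℕ) {N : ℕ}
    (hN : N = 2 * s + m + n) {C : ℝ} (hC : C ≤ 1) :
    C / (2 ^ N * √(N : ℝ)) * ((N.choose (2 * s) : ℝ) * (m + n).choose m) ≤
        ((n + s).choose s : ℝ) * (s + m - 1).choose (s - 1) / 4 ^ s ∧
      ((n + s).choose s : ℝ) * (s + m - 1).choose (s - 1) / 4 ^ s ≤
        1 / √(N : ℝ) * ((N.choose (2 * s) : ℝ) * (m + n).choose m) := by
  have key := Nat.choose_mul_choose_mul_mul_choose hs m n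
  rw [← hN] at key
  rw [← Nat.cast_mul, ← Nat.cast_mul]
  generalize (n + s).choose s * (s + m - 1).choose (s - 1) = A at key ⊢
  generalize N.choose (2 * s) * (m + n).choose m = B at key ⊢
  have hN0 : 0 < √(N : ℝ) := Real.sqrt_pos.2 (by exact_mod_cast (by omega : 0 < N))
  have hsq : √(N : ℝ) * √(N : ℝ) = N := Real.mul_self_sqrt (Nat.cast_nonneg N)
  have hN1 : 1 ≤ √(N : ℝ) := Real.one_le_sqrt.2 (by exact_mod_cast (by omega : 1 ≤ N))
  constructor
  · have hlow : B * 4 ^ s ≤ A * (2 * (N * (N - 1).choose (m + s - 1))) := by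
      have h4 := Nat.four_pow_le_two_mul_self_mul_centralBinom s hs
      have hk : N * (N - 1).choose (m + s - 1) = (m + s) * N.choose (m + s) := by
        have := Nat.add_one_mul_choose_eq (N - 1) (m + s - 1)
        rw [Nat.sub_add_cancel (by omega), Nat.sub_add_cancel (by omega)] at this
        linarith
      rw [hk]
      calc B * 4 ^ s ≤ B * (2 * s * s.centralBinom) := by gcongr
        _ = 2 * (B * (s * s.centralBinom)) := by ring
        _ = _ := by rw [← key]; ring
    have hlow' : (B : ℝ) * 4 ^ s ≤ A * (2 * (N * (N - 1).choose (m + s - 1))) := by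
      exact_mod_cast hlow
    have hch := Nat.choose_mul_sqrt_le (N - 1) (m + s - 1)
    rw [Nat.cast_sub (by omega : 1 ≤ N), Nat.cast_one, sub_add_cancel] at hch
    have hp : (2 : ℝ) ^ N = 2 * 2 ^ (N - 1) := by
      rw [← pow_succ', Nat.sub_add_cancel (by omega)]
    rw [div_mul_eq_mul_div, div_le_div_iff₀ (by positivity) (by positivity)]
    calc C * B * 4 ^ s ≤ 1 * B * 4 ^ s := by gcongr
      _ = B * 4 ^ s := by ring
      _ ≤ A * (2 * (N * (N - 1).choose (m + s - 1))) := hlow'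
      _ = A * (2 * (((N - 1).choose (m + s - 1) * √(N : ℝ)) * √(N : ℝ))) := by
        rw [mul_assoc _ (√(N : ℝ)), hsq]; ring
      _ ≤ A * (2 * (2 ^ (N - 1) * √(N : ℝ))) := by gcongr
      _ = A * (2 ^ N * √(N : ℝ)) := by rw [hp]; ring
  · have hup : A * N ≤ B * 4 ^ s := by
      refine Nat.le_of_mul_le_mul_left ?_ (show 0 < m + s by omega)
      have hle := Nat.le_choose_of_pos_of_lt (n := N) (k := m + s) (by omega) (by omega)
      have hcb : s.centralBinom ≤ 4 ^ s := by
        rw [Nat.centralBinom_eq_two_mul_choose]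
        exact (Nat.choose_le_two_pow _ _).trans_eq (by rw [pow_mul]; norm_num)
      calc (m + s) * (A * N) ≤ (m + s) * (A * N.choose (m + s)) := by gcongr
        _ = A * ((m + s) * N.choose (m + s)) := by ring
        _ = B * (s * s.centralBinom) := key
        _ ≤ B * ((m + s) * 4 ^ s) := by gcongr; omega
        _ = (m + s) * (B * 4 ^ s) := by ring
    have hup' : (A : ℝ) * N ≤ B * 4 ^ s := by exact_mod_cast hup
    rw [one_div_mul_eq_div, div_le_div_iff₀ (by positivity) hN0]
    refine le_trans ?_ hup'
    gcongr
    nlinarith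

theorem exp_mul_sqrt_two_div_pi_le_one :
    Real.exp (-(1 / 6 : ℝ)) * Real.sqrt (2 / Real.pi) ≤ 1 := by
  refine mul_le_one₀ (Real.exp_le_one_iff.2 (by norm_num)) (Real.sqrt_nonneg _)
    (Real.sqrt_le_one.2 ?_)
  rw [div_le_one Real.pi_pos]
  exact Real.two_le_pi

/-- Formula (2.15): the explicit sum `S_N` is squeezed between multiples of `T_N`. -/
theorem explicit_sum_squeezed
    (N : ℕ) (hN : 1 ≤ N) (u v w : ℝ) (hu : 0 < u) (hv : 0 < v) (hw : 0 < w)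
    (T S C₁ : ℝ)
    (hT : T = ∑ t ∈ Finset.Icc 1 N, ∑ s ∈ Finset.Icc 1 (t / 2),
        (N.choose (2 * s) : ℝ) * ((N - 2 * s).choose (t - 2 * s)) *
          (u + v) ^ s * (w / 2) ^ (t - 2 * s))
    (hS : S = 1 + ∑ t ∈ Finset.Icc 1 N, ∑ s ∈ Finset.Icc 1 (t / 2),
        ((N - t + s).choose s : ℝ) * ((t - s - 1).choose (s - 1)) *
          ((u + v) / 4) ^ s * (w / 2) ^ (t - 2 * s))
    (hC₁ : C₁ = Real.exp (-(1 / 6 : ℝ)) * Real.sqrt (2 / Real.pi)) :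
    1 + C₁ / (2 ^ N * Real.sqrt N) * T ≤ S ∧ S ≤ 1 + 1 / Real.sqrt N * T := by
  have hC : C₁ ≤ 1 := hC₁ ▸ exp_mul_sqrt_two_div_pi_le_one
  have main : ∀ t ∈ Finset.Icc 1 N, ∀ s ∈ Finset.Icc 1 (t / 2), _ := fun t ht s hs => by
    rw [Finset.mem_Icc] at ht hs
    have h := choose_mul_choose_squeezed hs.1 (t - 2 * s) (N - t) (N := N) (by omega) hC
    rw [show t - 2 * s + (N - t) = N - 2 * s by omega,
      show s + (t - 2 * s) - 1 = t - s - 1 by omega] at h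
    exact h
  have hpos : ∀ s m : ℕ, 0 ≤ (u + v) ^ s * (w / 2) ^ m := fun s m => by positivity
  subst hT hS
  simp only [add_le_add_iff_left, Finset.mul_sum]
  constructor <;> refine Finset.sum_le_sum fun t ht => Finset.sum_le_sum fun s hs => ?_
  · convert mul_le_mul_of_nonneg_right (main t ht s hs).1 (hpos s (t - 2 * s)) using 1
    · ring
    · rw [div_pow]; ring
  · convert mul_le_mul_of_nonneg_right (main t ht s hs).2 (hpos s (t - 2 * s)) using 1
    · rw [div_pow]; ring
    · ring
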